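/- Let f: D×D → ℂ be holomorphic on D×D with f(z₁+1,z₂) = f(z₁,z₂+1) = f(z₁,z₂), where D = {z : |Im z| < Im τ / 2}. Let μ ∉ ℤ + ℤτ and ξ ∈ ℂ. Define, for z₂ − z₁ ∉ ℤ, (Ř(ξ)f)(z₁,z₂) = [θ₁(ξ)θ₁(z₂−z₁−μ)θ₁'(0)/(θ₁(−μ)θ₁(z₂−z₁))]·f(z₂,z₁) + [θ₁(z₂−z₁−ξ)θ₁'(0)/θ₁(z₂−z₁)]·f(z₁,z₂). Then there is a unique holomorphic function F on D×D agreeing with Ř(ξ)f off the set X = {(z₁,z₂) : z₂−z₁ ∈ ℤ}; moreover F(z, z+m) = [(θ₁(ξ)θ₁'(−μ)+θ₁'(−ξ)θ₁(−μ))/θ₁(−μ)]·f(z,z) + θ₁(ξ)·(∂₁f(z,z) − ∂₂f(z,z)) for every integer m with (z, z+m) ∈ D×D. -/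

import Mathlib

open Complex

/-- The Jacobi theta function `θ₁(z, τ)`. -/
noncomputable def theta1 (τ z : ℂ) : ℂ :=
  ∑' m : ℤ, Complex.exp (Real.pi * I * ((m : ℂ) + 1/2)^2 * τ
    + 2 * Real.pi * I * ((m : ℂ) + 1/2) * (z + 1/2))

/-- The horizontal strip `D = {z : |Im z| < Im τ / 2}`. -/
def strip (τ : ℂ) : Set ℂ := {z : ℂ | |z.im| < τ.im / 2}

/-- The elliptic R-operator (raw formula, away from `z₂ - z₁ ∈ ℤ`). -/
noncomputable def Rop (τ μ ξ : ℂ) (f : ℂ → ℂ → ℂ) (z₁ z₂ : ℂ) : ℂ :=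
  theta1 τ ξ * theta1 τ (z₂ - z₁ - μ) * deriv (theta1 τ) 0 /
      (theta1 τ (-μ) * theta1 τ (z₂ - z₁)) * f z₂ z₁
    + theta1 τ (z₂ - z₁ - ξ) * deriv (theta1 τ) 0 / theta1 τ (z₂ - z₁) * f z₁ z₂

open Filter Topology

/-- Gaussian binomial coefficients, by the `q`-Pascal recursion. -/
def qChoose {R : Type*} [CommRing R] (q : R) : ℕ → ℕ → R
  | _, 0 => 1
  | 0, _ + 1 => 0
  | n + 1, k + 1 => qChoose q n (k + 1) + q ^ (n - k) * qChoose q n k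

lemma qChoose_eq_zero_of_lt {R : Type*} [CommRing R] (q : R) {n k : ℕ} (h : n < k) :
    qChoose q n k = 0 := by
  induction n generalizing k with
  | zero => obtain ⟨k, rfl⟩ := Nat.exists_eq_add_of_lt h; rw [qChoose]
  | succ n ih =>
    obtain ⟨k, rfl⟩ : ∃ l, k = l + 1 := ⟨k - 1, by omega⟩
    rw [qChoose, ih (by omega), ih (by omega)]
    ring

lemma qChoose_self {R : Type*} [CommRing R] (q : R) (n : ℕ) : qChoose q n n = 1 := by
  induction n with
  | zero => rw [qChoose]
  | succ n ih => rw [qChoose, ih, qChoose_eq_zero_of_lt q (Nat.lt_succ_self n)]; simp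

/-- The `q`-factorial-like product `∏ (1 - q ^ (k + 1))` over `k < n`. -/
def qPoch {R : Type*} [CommRing R] (q : R) (n : ℕ) : R := ∏ k ∈ Finset.range n, (1 - q ^ (k + 1))

lemma qChoose_mul_qPoch {R : Type*} [CommRing R] (q : R) (i j : ℕ) :
    qChoose q (i + j) i * (qPoch q i * qPoch q j) = qPoch q (i + j) := by
  obtain ⟨n, hn⟩ : ∃ n, i + j = n := ⟨_, rfl⟩
  induction n generalizing i j with
  | zero =>
    obtain ⟨rfl, rfl⟩ : i = 0 ∧ j = 0 := by omega
    simp [qChoose, qPoch]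
  | succ n ih =>
    rcases i with _ | i
    · simp [qChoose, qPoch]
    rcases j with _ | j
    · simp [qChoose_self, qPoch]
    have h1 := ih (i + 1) j (by omega)
    have h2 := ih i (j + 1) (by omega)
    have e1 : i + 1 + j = i + j + 1 := by omega
    have e2 : i + (j + 1) = i + j + 1 := by omega
    have e3 : i + 1 + (j + 1) = i + j + 1 + 1 := by omega
    rw [e1] at h1
    rw [e2] at h2
    rw [e3, qChoose, show i + j + 1 - i = j + 1 by omega]
    have p (m : ℕ) : qPoch q (m + 1) = qPoch q m * (1 - q ^ (m + 1)) := Finset.prod_range_succ _ _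
    rw [p (i + j + 1), p j, p i]
    rw [p i] at h1
    rw [p j] at h2
    linear_combination (1 - q ^ (j + 1)) * h1 + q ^ (j + 1) * (1 - q ^ (i + 1)) * h2

/-- Euler's finite `q`-binomial theorem. -/
lemma prod_one_add_mul_pow_odd {R : Type*} [CommRing R] (p v : R) (n : ℕ) :
    ∏ k ∈ Finset.range n, (1 + v * p ^ (2 * k + 1)) =
      ∑ j ∈ Finset.range (n + 1), qChoose (p ^ 2) n j * p ^ (j ^ 2) * v ^ j := by
  induction n with
  | zero => simp [qChoose]
  | succ n ih =>
    have h1 : ∑ j ∈ Finset.range (n + 1 + 1), qChoose (p ^ 2) (n + 1) j * p ^ (j ^ 2) * v ^ j =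
        (∑ j ∈ Finset.range (n + 1), (qChoose (p ^ 2) n (j + 1) * p ^ ((j + 1) ^ 2) * v ^ (j + 1)
          + qChoose (p ^ 2) n j * p ^ (j ^ 2) * v ^ j * (v * p ^ (2 * n + 1)))) + 1 := by
      rw [Finset.sum_range_succ']
      congr 1
      · refine Finset.sum_congr rfl fun j hj => ?_
        obtain ⟨d, rfl⟩ : ∃ d, n = j + d := ⟨n - j, by grind⟩
        rw [qChoose, Nat.add_sub_cancel_left]
        ring
      · simp [qChoose]
    have h2 : (∑ j ∈ Finset.range (n + 1),
        qChoose (p ^ 2) n (j + 1) * p ^ ((j + 1) ^ 2) * v ^ (j + 1)) + 1 =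
        ∑ j ∈ Finset.range (n + 1), qChoose (p ^ 2) n j * p ^ (j ^ 2) * v ^ j := by
      rw [Finset.sum_range_succ, qChoose_eq_zero_of_lt _ (Nat.lt_succ_self n),
        Finset.sum_range_succ']
      simp [qChoose]
    rw [h1, Finset.sum_add_distrib, ← Finset.sum_mul, Finset.prod_range_succ, ih]
    linear_combination -h2

/-- The finite form of the Jacobi triple product. -/
lemma prod_one_add_mul_one_add_div {K : Type*} [Field K] {p y : K} (hp : p ≠ 0) (hy : y ≠ 0)
    (n : ℕ) :
    ∏ k ∈ Finset.range n, ((1 + y * p ^ (2 * k + 1)) * (1 + y⁻¹ * p ^ (2 * k + 1))) =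
      ∑ m ∈ Finset.Icc (-n : ℤ) n,
        qChoose (p ^ 2) (2 * n) (n + m).toNat * (p ^ (m ^ 2) * y ^ m) := by
  have key := prod_one_add_mul_pow_odd p (y * p⁻¹ ^ (2 * n)) (2 * n)
  have hL : ∏ k ∈ Finset.range (2 * n), (1 + y * p⁻¹ ^ (2 * n) * p ^ (2 * k + 1)) =
      y ^ n * p⁻¹ ^ (n ^ 2) *
        ∏ k ∈ Finset.range n, ((1 + y * p ^ (2 * k + 1)) * (1 + y⁻¹ * p ^ (2 * k + 1))) := by
    have h1 : ∏ k ∈ Finset.range n, (1 + y * p⁻¹ ^ (2 * n) * p ^ (2 * k + 1)) =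
        y ^ n * p⁻¹ ^ (n ^ 2) * ∏ k ∈ Finset.range n, (1 + y⁻¹ * p ^ (2 * k + 1)) := by
      have h3 : y ^ n * p⁻¹ ^ (n ^ 2) = ∏ k ∈ Finset.range n, (y * p⁻¹ ^ (2 * k + 1)) := by
        clear key
        induction n with
        | zero => simp
        | succ n ih => rw [Finset.prod_range_succ, ← ih]; ring
      rw [h3, ← Finset.prod_mul_distrib, ← Finset.prod_range_reflect]
      refine Finset.prod_congr rfl fun k hk => ?_
      obtain ⟨d, rfl⟩ : ∃ d, n = k + 1 + d := ⟨n - (k + 1), by grind⟩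
      rw [show k + 1 + d - 1 - k = d by omega]
      have h4 : p⁻¹ ^ (2 * (k + 1 + d)) * p ^ (2 * d + 1) = p⁻¹ ^ (2 * k + 1) := by
        rw [show 2 * (k + 1 + d) = (2 * k + 1) + (2 * d + 1) by ring, pow_add, mul_assoc,
          ← mul_pow, inv_mul_cancel₀ hp, one_pow, mul_one]
      have h5 : p⁻¹ ^ (2 * k + 1) * p ^ (2 * k + 1) = 1 := by
        rw [← mul_pow, inv_mul_cancel₀ hp, one_pow]
      rw [mul_assoc, h4]
      linear_combination -(y * y⁻¹) * h5 - mul_inv_cancel₀ hy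
    rw [two_mul, Finset.prod_range_add, ← two_mul, h1, Finset.prod_mul_distrib]
    have h2 : ∏ k ∈ Finset.range n, (1 + y * p⁻¹ ^ (2 * n) * p ^ (2 * (n + k) + 1)) =
        ∏ k ∈ Finset.range n, (1 + y * p ^ (2 * k + 1)) := by
      refine Finset.prod_congr rfl fun k hk => ?_
      rw [show 2 * (n + k) + 1 = 2 * n + (2 * k + 1) by ring, pow_add, mul_assoc,
          ← mul_assoc (_ ^ _),
        ← mul_pow, inv_mul_cancel₀ hp, one_pow, one_mul]
    rw [h2]
    ring
  have hc : y ^ n * p⁻¹ ^ (n ^ 2) ≠ 0 := by positivity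
  rw [hL] at key
  apply mul_left_cancel₀ hc
  rw [key, Finset.mul_sum]
  refine Finset.sum_nbij' (fun j => (j : ℤ) - n) (fun m => (n + m).toNat) ?_ ?_ ?_ ?_ ?_
  · intro j hj; simp at hj ⊢; omega
  · intro j hj; simp at hj ⊢; omega
  · intro j hj; simp
  · intro j hj; simp at hj ⊢; omega
  · intro j hj
    have h4 : p ^ (j ^ 2) * (y * p⁻¹ ^ (2 * n)) ^ j =
        y ^ n * p⁻¹ ^ (n ^ 2) * (p ^ (((j : ℤ) - n) ^ 2) * y ^ ((j : ℤ) - n)) := by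
      rw [zpow_sub₀ hy, show ((j : ℤ) - n) ^ 2 = ((j ^ 2 + n ^ 2 : ℕ) : ℤ) - ((2 * n * j : ℕ) : ℤ) by
        push_cast; ring, zpow_sub₀ hp]
      simp only [zpow_natCast]
      simp only [mul_pow, inv_pow, ← pow_mul, pow_add]
      field_simp
    simp only [add_sub_cancel, Int.toNat_natCast]
    rw [mul_assoc, h4]
    ring

/-- Euler's product `∏ (1 + v p ^ (2 k + 1))`. -/
noncomputable def eulerProd (p v : ℂ) : ℂ := ∏' k : ℕ, (1 + v * p ^ (2 * k + 1))

lemma summable_norm_pow_odd {p : ℂ} (hp : ‖p‖ < 1) (c : ℝ) :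
    Summable fun k : ℕ => c * ‖p‖ ^ (2 * k + 1) :=
  ((summable_geometric_of_lt_one (norm_nonneg p) hp).comp_injective
    (i := fun k : ℕ => 2 * k + 1) fun a b h => by simpa using h).mul_left c

lemma summable_norm_mul_pow_odd {p : ℂ} (hp : ‖p‖ < 1) (v : ℂ) :
    Summable fun k : ℕ => ‖v * p ^ (2 * k + 1)‖ := by
  simpa using summable_norm_pow_odd hp ‖v‖

lemma multipliable_eulerProd {p : ℂ} (hp : ‖p‖ < 1) (v : ℂ) :
    Multipliable fun k : ℕ => 1 + v * p ^ (2 * k + 1) :=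
  multipliable_one_add_of_summable (summable_norm_mul_pow_odd hp v)

lemma eulerProd_ne_zero {p : ℂ} (hp : ‖p‖ < 1) {v : ℂ}
    (hv : ∀ k : ℕ, 1 + v * p ^ (2 * k + 1) ≠ 0) : eulerProd p v ≠ 0 :=
  tprod_one_add_ne_zero_of_summable hv (summable_norm_mul_pow_odd hp v)

lemma eulerProd_eq_mul {p : ℂ} (hp : ‖p‖ < 1) (v : ℂ) :
    eulerProd p v = (1 + v * p) * eulerProd p (v * p ^ 2) := by
  rw [eulerProd, tprod_eq_zero_mul']
  · simp only [eulerProd, mul_zero, zero_add, pow_one]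
    congr 1
    refine tprod_congr fun k => ?_
    ring
  · convert multipliable_eulerProd hp (v * p ^ 2) using 2 with k
    ring

lemma continuous_eulerProd {p : ℂ} (hp : ‖p‖ < 1) : Continuous (eulerProd p) := by
  rw [continuous_iff_continuousAt]
  intro v
  have h := (summable_norm_pow_odd hp (‖v‖ + 1)).hasProdUniformlyOn_nat_one_add
    (f := fun (k : ℕ) w => w * p ^ (2 * k + 1)) (isCompact_closedBall v 1)
    (.of_forall fun k w hw => by
      rw [norm_mul, norm_pow]
      gcongr
      have := norm_le_norm_add_norm_sub' w v
      rw [mem_closedBall_iff_norm] at hw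
      linarith) (fun k => by fun_prop)
  have hc := h.tendstoUniformlyOn.continuousOn (.of_forall fun s => by fun_prop)
  exact hc.continuousAt (Metric.closedBall_mem_nhds v one_pos)

lemma qPoch_ne_zero {q : ℂ} (hq : ‖q‖ < 1) (n : ℕ) : qPoch q n ≠ 0 := by
  refine Finset.prod_ne_zero_iff.mpr fun k _ h => ?_
  have h1 : ‖q ^ (k + 1)‖ < 1 := by
    rw [norm_pow]
    exact pow_lt_one₀ (norm_nonneg _) hq (by omega)
  rw [← sub_eq_zero.mp h] at h1
  simp at h1

lemma exists_tendsto_qPoch {q : ℂ} (hq : ‖q‖ < 1) :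
    ∃ Q : ℂ, Q ≠ 0 ∧ Tendsto (qPoch q) atTop (𝓝 Q) := by
  have hs : Summable fun k : ℕ => ‖-q ^ (k + 1)‖ := by
    simpa using (summable_nat_add_iff 1).mpr (summable_geometric_of_lt_one (norm_nonneg _) hq)
  refine ⟨∏' k : ℕ, (1 + -q ^ (k + 1)), tprod_one_add_ne_zero_of_summable (fun k h => ?_) hs, ?_⟩
  · apply qPoch_ne_zero hq (k + 1)
    rw [qPoch, Finset.prod_range_succ, sub_eq_add_neg, h, mul_zero]
  · simpa only [← sub_eq_add_neg, qPoch, Function.comp_def] using!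
      (multipliable_one_add_of_summable hs).hasProd.tendsto_prod_nat

/-- The Jacobi triple product, up to a nonzero factor independent of `y`. -/
lemma exists_tsum_eq_mul_eulerProd {p : ℂ} (hp0 : p ≠ 0) (hp : ‖p‖ < 1) :
    ∃ Q : ℂ, Q ≠ 0 ∧ ∀ y : ℂ, y ≠ 0 → (Summable fun m : ℤ => p ^ (m ^ 2) * y ^ m) →
      ∑' m : ℤ, p ^ (m ^ 2) * y ^ m = Q * (eulerProd p y * eulerProd p y⁻¹) := by
  have hq : ‖p ^ 2‖ < 1 := by
    rw [norm_pow]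
    exact pow_lt_one₀ (norm_nonneg _) hp two_ne_zero
  obtain ⟨Q, hQ0, hQ⟩ := exists_tendsto_qPoch hq
  refine ⟨Q, hQ0, fun y hy hs => ?_⟩
  have hchoose {n : ℕ} {m : ℤ} (hm : m ∈ Finset.Icc (-n : ℤ) n) :
      qChoose (p ^ 2) (2 * n) (n + m).toNat =
        qPoch (p ^ 2) (2 * n) *
          ((qPoch (p ^ 2) (n + m).toNat)⁻¹ * (qPoch (p ^ 2) (n - m).toNat)⁻¹) := by
    rw [Finset.mem_Icc] at hm
    have h := qChoose_mul_qPoch (p ^ 2) (n + m).toNat (n - m).toNat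
    rw [show (n + m).toNat + (n - m).toNat = 2 * n by omega] at h
    rw [← h, ← mul_inv]
    exact (mul_inv_cancel_right₀ (mul_ne_zero (qPoch_ne_zero hq _) (qPoch_ne_zero hq _)) _).symm
  obtain ⟨B, hB⟩ := (Metric.isBounded_range_of_tendsto _ hQ).exists_norm_le
  obtain ⟨C, hC⟩ := (Metric.isBounded_range_of_tendsto _ (hQ.inv₀ hQ0)).exists_norm_le
  have hB' n : ‖qPoch (p ^ 2) n‖ ≤ B := hB _ ⟨n, rfl⟩
  have hC' n : ‖(qPoch (p ^ 2) n)⁻¹‖ ≤ C := hC _ ⟨n, rfl⟩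
  have hB0 : 0 ≤ B := (norm_nonneg _).trans (hB' 0)
  have hC0 : 0 ≤ C := (norm_nonneg _).trans (hC' 0)
  have hlim : Tendsto (fun n : ℕ => ∑' m : ℤ, if m ∈ Finset.Icc (-n : ℤ) n then
      qChoose (p ^ 2) (2 * n) (n + m).toNat * (p ^ (m ^ 2) * y ^ m) else 0) atTop
      (𝓝 (∑' m : ℤ, Q⁻¹ * (p ^ (m ^ 2) * y ^ m))) := by
    refine tendsto_tsum_of_dominated_convergence
      (bound := fun m => B * (C * C) * ‖p ^ (m ^ 2) * y ^ m‖) (hs.norm.mul_left _)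
      (fun m => ?_) (.of_forall fun n m => ?_)
    · have e1 : Tendsto (fun n : ℕ => 2 * n) atTop atTop :=
        tendsto_atTop_mono (fun n => by simp only [id]; omega) tendsto_id
      have e2 (k : ℤ) : Tendsto (fun n : ℕ => (n + k).toNat) atTop atTop :=
        tendsto_atTop_mono (f := fun n : ℕ => n - k.natAbs) (fun n => by omega)
          (tendsto_sub_atTop_nat _)
      have h := ((hQ.comp e1).mul (((hQ.comp (e2 m)).inv₀ hQ0).mul
        ((hQ.comp (e2 (-m))).inv₀ hQ0))).mul_const (p ^ (m ^ 2) * y ^ m)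
      rw [mul_inv_cancel_left₀ hQ0] at h
      refine h.congr' ?_
      filter_upwards [eventually_ge_atTop m.natAbs] with n hn
      have hm : m ∈ Finset.Icc (-n : ℤ) n := by rw [Finset.mem_Icc]; omega
      rw [if_pos hm, hchoose hm]
      rfl
    · split_ifs with hm
      · rw [norm_mul, hchoose hm, norm_mul, norm_mul]
        gcongr
        exacts [hB' _, hC' _, hC' _]
      · rw [norm_zero]
        positivity
  have hprod := ((multipliable_eulerProd hp y).hasProd.tendsto_prod_nat.mul
    (multipliable_eulerProd hp y⁻¹).hasProd.tendsto_prod_nat)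
  have heq := tendsto_nhds_unique hlim (hprod.congr fun n => by
    rw [← Finset.prod_mul_distrib, prod_one_add_mul_one_add_div hp0 hy, tsum_eq_sum]
    · exact Finset.sum_congr rfl fun m hm => (if_pos hm).symm
    · exact fun m hm => if_neg hm)
  rw [tsum_mul_left] at heq
  rw [eulerProd, eulerProd, ← heq, mul_inv_cancel_left₀ hQ0]

/-- The partial derivative in the first variable of a continuous, separately holomorphic function
is continuous. -/
lemma continuousAt_deriv_fst_of_separately {g : ℂ × ℂ → ℂ} {U : Set (ℂ × ℂ)} (hU : IsOpen U)
    (hg : ContinuousOn g U)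
    (h1 : ∀ p ∈ U, DifferentiableAt ℂ (fun x => g (x, p.2)) p.1) {p : ℂ × ℂ} (hp : p ∈ U) :
    ContinuousAt (fun q : ℂ × ℂ => deriv (fun x => g (x, q.2)) q.1) p := by
  obtain ⟨r, hr, hrU⟩ := Metric.isOpen_iff.mp hU p hp
  have hball {x y : ℂ} (hx : x ∈ Metric.ball p.1 r) (hy : y ∈ Metric.ball p.2 r) : (x, y) ∈ U :=
    hrU (by rw [← ball_prod_same]; exact ⟨hx, hy⟩)
  have hev : ∀ᶠ q : ℂ × ℂ in 𝓝 p, q.2 ∈ Metric.ball p.2 r :=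
    continuous_snd.continuousAt.eventually_mem (Metric.ball_mem_nhds _ hr)
  have hunif : TendstoLocallyUniformlyOn (fun (q : ℂ × ℂ) x => g (x, q.2)) (fun x => g (x, p.2))
      (𝓝 p) (Metric.ball p.1 r) := by
    rw [Metric.tendstoLocallyUniformlyOn_iff]
    intro ε hε x hx
    have hc : ContinuousAt g (x, p.2) :=
      hg.continuousAt (hU.mem_nhds (hball hx (Metric.mem_ball_self hr)))
    have h := hc.eventually (Metric.ball_mem_nhds _ (half_pos hε))
    rw [nhds_prod_eq] at h
    obtain ⟨t, ht, s, hs, hts⟩ := mem_prod_iff.mp h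
    refine ⟨t, mem_nhdsWithin_of_mem_nhds ht, ?_⟩
    filter_upwards [continuous_snd.continuousAt.eventually_mem hs] with q hq y hy
    have e1 : dist (g (y, p.2)) (g (x, p.2)) < ε / 2 := hts ⟨hy, mem_of_mem_nhds hs⟩
    have e2 : dist (g (y, q.2)) (g (x, p.2)) < ε / 2 := hts ⟨hy, hq⟩
    linarith [dist_triangle_right (g (y, p.2)) (g (y, q.2)) (g (x, p.2))]
  have hd : ∀ᶠ q : ℂ × ℂ in 𝓝 p,
      DifferentiableOn ℂ (fun x => g (x, q.2)) (Metric.ball p.1 r) := by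
    filter_upwards [hev] with q hq x hx
    exact (h1 (x, q.2) (hball hx hq)).differentiableWithinAt
  have hlim := hunif.deriv hd Metric.isOpen_ball
  have hcont : ContinuousWithinAt (deriv fun x => g (x, p.2)) (Metric.ball p.1 r) p.1 :=
    ((hd.self_of_nhds.deriv Metric.isOpen_ball).continuousOn) _ (Metric.mem_ball_self hr)
  refine hlim.tendsto_comp hcont (Metric.mem_ball_self hr) ?_
  rw [Metric.isOpen_ball.nhdsWithin_eq (Metric.mem_ball_self hr)]
  exact continuous_fst.continuousAt

/-- Osgood's lemma: a continuous, separately holomorphic function is strictly differentiable. -/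
lemma exists_hasStrictFDerivAt_of_separately {g : ℂ × ℂ → ℂ} {U : Set (ℂ × ℂ)} (hU : IsOpen U)
    (hg : ContinuousOn g U)
    (h1 : ∀ p ∈ U, DifferentiableAt ℂ (fun x => g (x, p.2)) p.1)
    (h2 : ∀ p ∈ U, DifferentiableAt ℂ (fun y => g (p.1, y)) p.2) {p : ℂ × ℂ} (hp : p ∈ U) :
    ∃ L : ℂ × ℂ →L[ℂ] ℂ, HasStrictFDerivAt g L p := by
  have c1 := continuousAt_deriv_fst_of_separately hU hg h1 hp
  have c2 : ContinuousAt (fun q : ℂ × ℂ => deriv (fun y => g (q.1, y)) q.2) p := by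
    have := continuousAt_deriv_fst_of_separately (g := g ∘ Prod.swap) (U := Prod.swap ⁻¹' U)
      (hU.preimage continuous_swap) (hg.comp continuous_swap.continuousOn fun _ h => h)
      (fun q hq => h2 q.swap hq) (p := p.swap) (by simpa using hp)
    exact this.comp continuous_swap.continuousAt
  have hs := hasStrictFDerivAt_uncurry_coprod (𝕜 := ℂ) (u := p) (f := fun x y => g (x, y))
    (f₁ := fun x y => ContinuousLinearMap.toSpanSingleton ℂ (deriv (fun x => g (x, y)) x))
    (f₂ := fun x y => ContinuousLinearMap.toSpanSingleton ℂ (deriv (fun y => g (x, y)) y))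
    (by filter_upwards [hU.mem_nhds hp] with q hq using (h1 q hq).hasDerivAt.hasFDerivAt)
    (by filter_upwards [hU.mem_nhds hp] with q hq using (h2 q hq).hasDerivAt.hasFDerivAt)
    ((ContinuousLinearMap.toSpanSingletonCLE (𝕜 := ℂ) (E := ℂ)).continuous.continuousAt.comp c1)
    ((ContinuousLinearMap.toSpanSingletonCLE (𝕜 := ℂ) (E := ℂ)).continuous.continuousAt.comp c2)
  exact ⟨_, hs⟩

lemma DifferentiableOn.exists_hasStrictFDerivAt {g : ℂ × ℂ → ℂ} {U : Set (ℂ × ℂ)} (hU : IsOpen U)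
    (hg : DifferentiableOn ℂ g U) {p : ℂ × ℂ} (hp : p ∈ U) :
    ∃ L : ℂ × ℂ →L[ℂ] ℂ, HasStrictFDerivAt g L p := by
  refine exists_hasStrictFDerivAt_of_separately hU hg.continuousOn (fun q hq => ?_)
    (fun q hq => ?_) hp
  · exact (hg.differentiableAt (hU.mem_nhds hq)).comp (f := fun x => (x, q.2)) q.1 (by fun_prop)
  · exact (hg.differentiableAt (hU.mem_nhds hq)).comp (f := fun y => (q.1, y)) q.2 (by fun_prop)

/-- A continuous function on `U` that is holomorphic on `A` is holomorphic on `U`, if every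
horizontal and every vertical line through a point of `U` stays in `A` on a punctured
neighbourhood of that point. -/
lemma differentiableOn_of_continuousOn_of_punctured {g : ℂ × ℂ → ℂ} {U A : Set (ℂ × ℂ)}
    (hU : IsOpen U) (hg : ContinuousOn g U) (hA : ∀ p ∈ U ∩ A, DifferentiableAt ℂ g p)
    (hA1 : ∀ p ∈ U, ∀ᶠ x in 𝓝[≠] p.1, (x, p.2) ∈ A)
    (hA2 : ∀ p ∈ U, ∀ᶠ y in 𝓝[≠] p.2, (p.1, y) ∈ A) : DifferentiableOn ℂ g U := by
  have key {x : ℂ} {l : ℂ → ℂ × ℂ} (hl : Differentiable ℂ l) (hx : l x ∈ U)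
      (hlA : ∀ᶠ t in 𝓝[≠] x, l t ∈ A) : DifferentiableAt ℂ (fun t => g (l t)) x := by
    refine (analyticAt_of_differentiable_on_punctured_nhds_of_continuousAt ?_ ?_).differentiableAt
    · filter_upwards [hlA, nhdsWithin_le_nhds
        (hl.continuous.continuousAt.eventually_mem (hU.mem_nhds hx))] with t ht hu
      exact (hA _ ⟨hu, ht⟩).comp t (hl t)
    · exact ContinuousAt.comp (hg.continuousAt (hU.mem_nhds hx)) hl.continuous.continuousAt
  intro p hp
  obtain ⟨L, hL⟩ := exists_hasStrictFDerivAt_of_separately hU hg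
    (fun q hq => key (l := fun x => (x, q.2)) (by fun_prop) hq (hA1 q hq))
    (fun q hq => key (l := fun y => (q.1, y)) (by fun_prop) hq (hA2 q hq)) hp
  exact hL.hasFDerivAt.differentiableAt.differentiableWithinAt

lemma theta1_eq_jacobiTheta₂ (τ z : ℂ) :
    theta1 τ z = cexp (Real.pi * I * (τ / 4 + z + 1 / 2)) *
      jacobiTheta₂ (z + 1 / 2 + τ / 2) τ := by
  rw [theta1, jacobiTheta₂, ← tsum_mul_left]
  refine tsum_congr fun m => ?_
  rw [jacobiTheta₂_term, ← Complex.exp_add]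
  ring_nf

lemma differentiable_theta1 {τ : ℂ} (hτ : 0 < τ.im) : Differentiable ℂ (theta1 τ) := by
  rw [funext (theta1_eq_jacobiTheta₂ τ)]
  intro z
  exact DifferentiableAt.mul (by fun_prop) ((differentiableAt_jacobiTheta₂_fst _ hτ).comp
    (f := fun z => z + 1 / 2 + τ / 2) z (by fun_prop))

lemma theta1_neg (τ z : ℂ) : theta1 τ (-z) = -theta1 τ z := by
  rw [theta1, theta1, ← ((Equiv.addRight (1 : ℤ)).trans (Equiv.neg ℤ)).tsum_eq, ← tsum_neg]
  refine tsum_congr fun m => ?_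
  rw [← Complex.exp_add_pi_mul_I, ← Complex.exp_periodic.int_mul (m + 1)]
  congr 1
  simp only [Equiv.trans_apply, Equiv.coe_addRight, Equiv.neg_apply]
  push_cast
  ring

lemma theta1_add_one (τ z : ℂ) : theta1 τ (z + 1) = -theta1 τ z := by
  rw [theta1, theta1, ← tsum_neg]
  refine tsum_congr fun m => ?_
  rw [← Complex.exp_add_pi_mul_I, ← Complex.exp_periodic.int_mul (-m)]
  congr 1
  push_cast
  ring

lemma norm_exp_pi_I_mul_lt_one {τ : ℂ} (hτ : 0 < τ.im) : ‖cexp (Real.pi * I * τ)‖ < 1 := by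
  rw [Complex.norm_exp, Real.exp_lt_one_iff]
  simpa using mul_pos Real.pi_pos hτ

/-- The product expansion of `θ₁`, up to a nonzero constant. -/
lemma exists_theta1_eq_mul {τ : ℂ} (hτ : 0 < τ.im) :
    ∃ Q : ℂ, Q ≠ 0 ∧ ∀ z, theta1 τ z = cexp (Real.pi * I * (τ / 4 + z + 1 / 2)) * Q *
      eulerProd (cexp (Real.pi * I * τ)) (-cexp (2 * Real.pi * I * z) * cexp (Real.pi * I * τ)) *
      eulerProd (cexp (Real.pi * I * τ)) (-cexp (-(2 * Real.pi * I * z)) * cexp (Real.pi * I * τ)) *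
      (1 - cexp (-(2 * Real.pi * I * z))) := by
  set p := cexp (Real.pi * I * τ) with hp_def
  have hp0 : p ≠ 0 := Complex.exp_ne_zero _
  have hp : ‖p‖ < 1 := norm_exp_pi_I_mul_lt_one hτ
  obtain ⟨Q, hQ0, hQ⟩ := exists_tsum_eq_mul_eulerProd hp0 hp
  refine ⟨Q, hQ0, fun z => ?_⟩
  have hterm (m : ℤ) : jacobiTheta₂_term m (z + 1 / 2 + τ / 2) τ =
      p ^ (m ^ 2) * (-cexp (2 * Real.pi * I * z) * p) ^ m := by
    rw [jacobiTheta₂_term, ← Complex.exp_add_pi_mul_I, hp_def, ← Complex.exp_add,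
      ← Complex.exp_int_mul, ← Complex.exp_int_mul, ← Complex.exp_add]
    congr 1
    push_cast
    ring
  have hy0 : -cexp (2 * Real.pi * I * z) * p ≠ 0 :=
    mul_ne_zero (neg_ne_zero.mpr (Complex.exp_ne_zero _)) hp0
  have hs := (summable_jacobiTheta₂_term_iff (z + 1 / 2 + τ / 2) τ).mpr hτ
  have hinv : (-cexp (2 * Real.pi * I * z) * p)⁻¹ * p = -cexp (-(2 * Real.pi * I * z)) := by
    rw [mul_inv, inv_mul_cancel_right₀ hp0, inv_neg, Complex.exp_neg]
  rw [theta1_eq_jacobiTheta₂, jacobiTheta₂]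
  simp only [hterm] at hs ⊢
  rw [hQ _ hy0 hs, eulerProd_eq_mul hp _⁻¹, pow_two p, ← mul_assoc _⁻¹ p p, hinv]
  ring

lemma exists_eq_of_theta1_eq_zero {τ : ℂ} (hτ : 0 < τ.im) {z : ℂ} (hz : theta1 τ z = 0) :
    ∃ a b : ℤ, z = a + b * τ := by
  obtain ⟨Q, hQ0, hQ⟩ := exists_theta1_eq_mul hτ
  have hp : ‖cexp (Real.pi * I * τ)‖ < 1 := norm_exp_pi_I_mul_lt_one hτ
  by_contra! h
  have key (b : ℤ) : cexp (2 * Real.pi * I * (z + b * τ)) ≠ 1 := by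
    intro hb
    obtain ⟨n, hn⟩ := Complex.exp_eq_one_iff.mp hb
    refine h n (-b) ?_
    rw [mul_comm (n : ℂ)] at hn
    have := mul_left_cancel₀ two_pi_I_ne_zero hn
    push_cast
    linear_combination this
  have key' (b : ℤ) : cexp (-(2 * Real.pi * I * (z + b * τ))) ≠ 1 := by
    rw [Complex.exp_neg, Ne, inv_eq_one]
    exact key b
  refine absurd (hz ▸ hQ z).symm ?_
  refine mul_ne_zero (mul_ne_zero (mul_ne_zero (mul_ne_zero (Complex.exp_ne_zero _) hQ0)
    (eulerProd_ne_zero hp fun k => ?_)) (eulerProd_ne_zero hp fun k => ?_)) ?_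
  · rw [mul_assoc, ← pow_succ', ← Complex.exp_nat_mul, neg_mul, ← Complex.exp_add,
      ← sub_eq_add_neg, sub_ne_zero]
    convert (key (k + 1)).symm using 2
    push_cast
    ring
  · rw [mul_assoc, ← pow_succ', ← Complex.exp_nat_mul, neg_mul, ← Complex.exp_add,
      ← sub_eq_add_neg, sub_ne_zero]
    convert (key' (-(k + 1))).symm using 2
    push_cast
    ring
  · rw [sub_ne_zero]
    convert (key' 0).symm using 2
    push_cast
    ring

lemma deriv_theta1_zero_ne_zero {τ : ℂ} (hτ : 0 < τ.im) : deriv (theta1 τ) 0 ≠ 0 := by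
  obtain ⟨Q, hQ0, hQ⟩ := exists_theta1_eq_mul hτ
  have hp : ‖cexp (Real.pi * I * τ)‖ < 1 := norm_exp_pi_I_mul_lt_one hτ
  set p := cexp (Real.pi * I * τ)
  have hE := continuous_eulerProd hp
  have hE1 : eulerProd p (-1 * p) ≠ 0 := eulerProd_ne_zero hp fun k h => by
    have h1 : p ^ (2 * k + 2) = 1 := by linear_combination -h
    have h2 : ‖p ^ (2 * k + 2)‖ < 1 := by
      rw [norm_pow]
      exact pow_lt_one₀ (norm_nonneg _) hp (by omega)
    simp [h1] at h2
  set H : ℂ → ℂ := fun z => cexp (Real.pi * I * (τ / 4 + z + 1 / 2)) * Q *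
      eulerProd p (-cexp (2 * Real.pi * I * z) * p) *
      eulerProd p (-cexp (-(2 * Real.pi * I * z)) * p) with hH
  have hHc : Continuous H := by fun_prop
  have hH0 : H 0 ≠ 0 := by
    simp only [hH, mul_zero, neg_zero, Complex.exp_zero]
    exact mul_ne_zero (mul_ne_zero (mul_ne_zero (Complex.exp_ne_zero _) hQ0) hE1) hE1
  have hu : HasDerivAt (fun z : ℂ => 1 - cexp (-(2 * Real.pi * I * z))) (2 * Real.pi * I) 0 := by
    have h := (((hasDerivAt_id (0 : ℂ)).const_mul (2 * Real.pi * I)).neg.cexp).const_sub 1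
    exact h.congr_deriv (by simp)
  have hd : HasDerivAt (theta1 τ) (H 0 * (2 * Real.pi * I)) 0 := by
    rw [hasDerivAt_iff_tendsto_slope] at hu ⊢
    refine (((hHc.tendsto 0).mono_left nhdsWithin_le_nhds).mul hu).congr fun z => ?_
    have hz : theta1 τ z = H z * (1 - cexp (-(2 * Real.pi * I * z))) := hQ z
    have h0 : theta1 τ 0 = 0 := by simp [hQ 0]
    rw [slope_def_field, slope_def_field, hz, h0]
    simp only [mul_zero, neg_zero, Complex.exp_zero]
    ring
  rw [hd.deriv]
  exact mul_ne_zero hH0 two_pi_I_ne_zero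

/-- The difference quotient, transversally to the diagonal, of a strictly differentiable function
vanishing on the diagonal. -/
lemma HasStrictFDerivAt.tendsto_div_sub {N : ℂ × ℂ → ℂ} {L : ℂ × ℂ →L[ℂ] ℂ} {a : ℂ}
    (hN : HasStrictFDerivAt N L (a, a)) (h0 : ∀ z, N (z, z) = 0) {A : Set (ℂ × ℂ)}
    (hA : ∀ p ∈ A, p.2 - p.1 ≠ 0) :
    Tendsto (fun p => N p / (p.2 - p.1)) (𝓝[A] (a, a)) (𝓝 (L (0, 1))) := by
  have ht : Tendsto (fun p : ℂ × ℂ => (p, (p.1, p.1))) (𝓝[A] (a, a)) (𝓝 ((a, a), (a, a))) :=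
    (Continuous.tendsto (by fun_prop) (a, a)).mono_left nhdsWithin_le_nhds
  have ho := hN.isLittleO.comp_tendsto ht
  have hL (v : ℂ) : L (0, v) = v * L (0, 1) := by
    rw [← smul_eq_mul, ← map_smul]
    simp
  have hsub (p : ℂ × ℂ) : p - (p.1, p.1) = (0, p.2 - p.1) := Prod.ext (sub_self _) rfl
  have ho' : (fun p : ℂ × ℂ => N p - (p.2 - p.1) * L (0, 1)) =o[𝓝[A] (a, a)]
      fun p => p.2 - p.1 := by
    refine (ho.congr (fun p => ?_) fun p => rfl).trans_isBigO
      (Asymptotics.IsBigO.of_bound 1 (.of_forall fun p => ?_))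
    · simp only [Function.comp_apply, h0, hsub, sub_zero, hL (p.2 - p.1)]
    · simp only [Function.comp_apply, hsub]
      simp [Prod.norm_def]
  have h := ho'.tendsto_div_nhds_zero.add_const (L (0, 1))
  rw [zero_add] at h
  refine h.congr' ?_
  filter_upwards [self_mem_nhdsWithin] with p hp
  have := hA p hp
  field_simp
  ring

lemma isOpen_strip (τ : ℂ) : IsOpen (strip τ) :=
  isOpen_lt (by fun_prop) continuous_const

lemma eventually_ne_intCast (c : ℂ) : ∀ᶠ w : ℂ in 𝓝[≠] c, ¬∃ m : ℤ, w = (m : ℂ) := by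
  by_cases hc : ∃ n : ℤ, c = (n : ℂ)
  · obtain ⟨n, rfl⟩ := hc
    filter_upwards [self_mem_nhdsWithin, nhdsWithin_le_nhds (Metric.ball_mem_nhds (n : ℂ) one_pos)]
    rintro w hw hball ⟨m, rfl⟩
    refine hw ?_
    rw [Metric.mem_ball, dist_eq_norm, ← Int.cast_sub, Complex.norm_intCast, ← Int.cast_abs] at hball
    have h1 : |m - n| < 1 := by exact_mod_cast hball
    have h2 : m = n := by rw [Int.abs_lt_one_iff] at h1; omega
    rw [Set.mem_singleton_iff, h2]
  · refine nhdsWithin_le_nhds ?_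
    filter_upwards [Complex.isOpen_compl_range_intCast.mem_nhds (x := c)
      (fun ⟨n, hn⟩ => hc ⟨n, hn.symm⟩)] with w hw ⟨m, hm⟩
    exact hw ⟨m, hm.symm⟩

/-- The complement of the singular set `z₂ - z₁ ∈ ℤ`. -/
def offInt : Set (ℂ × ℂ) := {p | ¬∃ m : ℤ, p.2 - p.1 = m}

lemma isOpen_offInt : IsOpen offInt := by
  have h : offInt = (fun p : ℂ × ℂ => p.2 - p.1) ⁻¹' (Set.range ((↑) : ℤ → ℂ))ᶜ := by
    ext p
    simp [offInt, eq_comm]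
  rw [h]
  exact Complex.isOpen_compl_range_intCast.preimage (by fun_prop)

lemma eventually_mem_offInt_snd (p : ℂ × ℂ) : ∀ᶠ y in 𝓝[≠] p.2, (p.1, y) ∈ offInt := by
  have ht : Tendsto (fun y => y - p.1) (𝓝[≠] p.2) (𝓝[≠] (p.2 - p.1)) :=
    (continuousWithinAt_id.sub continuousWithinAt_const).tendsto_nhdsWithin
      fun y hy h => hy (sub_left_injective h)
  exact ht.eventually (eventually_ne_intCast _)

lemma eventually_mem_offInt_fst (p : ℂ × ℂ) : ∀ᶠ x in 𝓝[≠] p.1, (x, p.2) ∈ offInt := by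
  have ht : Tendsto (fun x => p.2 - x) (𝓝[≠] p.1) (𝓝[≠] (p.2 - p.1)) :=
    (continuousWithinAt_const.sub continuousWithinAt_id).tendsto_nhdsWithin
      fun y hy h => hy (sub_right_injective h)
  exact ht.eventually (eventually_ne_intCast _)

lemma dense_offInt : Dense offInt := by
  intro p
  have ht : Tendsto (fun y => (p.1, y)) (𝓝[≠] p.2) (𝓝 p) :=
    (Continuous.tendsto (by fun_prop) p.2).mono_left nhdsWithin_le_nhds
  exact mem_closure_of_tendsto ht (eventually_mem_offInt_snd p)

lemma theta1_sub_ne_zero {τ : ℂ} (hτ : 0 < τ.im) {z₁ z₂ : ℂ} (h1 : z₁ ∈ strip τ)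
    (h2 : z₂ ∈ strip τ) (h : ¬∃ m : ℤ, z₂ - z₁ = m) : theta1 τ (z₂ - z₁) ≠ 0 := by
  intro h0
  obtain ⟨a, b, hab⟩ := exists_eq_of_theta1_eq_zero hτ h0
  have him : z₂.im - z₁.im = b * τ.im := by simpa using congrArg Complex.im hab
  simp only [strip, Set.mem_ofPred_eq, abs_lt] at h1 h2
  have hb1 : (b : ℝ) < 1 := by nlinarith
  have hb2 : (-1 : ℝ) < b := by nlinarith
  have hb : b = 0 := by
    have h3 : b < 1 := by exact_mod_cast hb1
    have h4 : -1 < b := by exact_mod_cast hb2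
    omega
  exact h ⟨a, by simpa [hb] using hab⟩

lemma Rop_add_intCast (τ μ ξ : ℂ) {f : ℂ → ℂ → ℂ} (hper1 : ∀ z₁ z₂, f (z₁ + 1) z₂ = f z₁ z₂)
    (hper2 : ∀ z₁ z₂, f z₁ (z₂ + 1) = f z₁ z₂) (z₁ z₂ : ℂ) (m : ℤ) :
    Rop τ μ ξ f z₁ (z₂ + m) = Rop τ μ ξ f z₁ z₂ := by
  have h : Function.Periodic (Rop τ μ ξ f z₁) 1 := fun w => by
    simp only [Rop]
    rw [show w + 1 - z₁ - μ = w - z₁ - μ + 1 by ring, show w + 1 - z₁ - ξ = w - z₁ - ξ + 1 by ring,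
      show w + 1 - z₁ = w - z₁ + 1 by ring, theta1_add_one, theta1_add_one, theta1_add_one, hper1,
      hper2]
    ring
  simpa using h.int_mul m z₂

/-- The numerator of `Rop`, over the denominator `θ₁(z₂ - z₁)`. -/
noncomputable def RopNum (τ μ ξ : ℂ) (f : ℂ → ℂ → ℂ) (p : ℂ × ℂ) : ℂ :=
  theta1 τ ξ * theta1 τ (p.2 - p.1 - μ) * deriv (theta1 τ) 0 / theta1 τ (-μ) * f p.2 p.1
    + theta1 τ (p.2 - p.1 - ξ) * deriv (theta1 τ) 0 * f p.1 p.2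

lemma Rop_eq_RopNum_div (τ μ ξ : ℂ) (f : ℂ → ℂ → ℂ) (p : ℂ × ℂ) :
    Rop τ μ ξ f p.1 p.2 = RopNum τ μ ξ f p / theta1 τ (p.2 - p.1) := by
  simp only [Rop, RopNum]
  ring

lemma differentiableOn_RopNum {τ : ℂ} (hτ : 0 < τ.im) (μ ξ : ℂ) {f : ℂ → ℂ → ℂ}
    (hf : DifferentiableOn ℂ (fun p : ℂ × ℂ => f p.1 p.2) (strip τ ×ˢ strip τ)) :
    DifferentiableOn ℂ (RopNum τ μ ξ f) (strip τ ×ˢ strip τ) := by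
  have hθ := differentiable_theta1 hτ
  have hf' : DifferentiableOn ℂ (fun p : ℂ × ℂ => f p.2 p.1) (strip τ ×ˢ strip τ) :=
    hf.comp (f := Prod.swap) (by unfold Prod.swap; fun_prop) fun p hp => ⟨hp.2, hp.1⟩
  have h1 : Differentiable ℂ fun p : ℂ × ℂ => theta1 τ (p.2 - p.1 - μ) :=
    hθ.comp (by fun_prop)
  have h2 : Differentiable ℂ fun p : ℂ × ℂ => theta1 τ (p.2 - p.1 - ξ) :=
    hθ.comp (by fun_prop)
  unfold RopNum
  simp only [div_eq_mul_inv]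
  exact ((((h1.const_mul _).mul_const _).mul_const _).differentiableOn.fun_mul hf').fun_add
    ((h2.mul_const _).differentiableOn.fun_mul hf)

lemma differentiableAt_Rop {τ : ℂ} (hτ : 0 < τ.im) (μ ξ : ℂ) {f : ℂ → ℂ → ℂ}
    (hf : DifferentiableOn ℂ (fun p : ℂ × ℂ => f p.1 p.2) (strip τ ×ˢ strip τ)) {p : ℂ × ℂ}
    (hp : p ∈ strip τ ×ˢ strip τ) (hpA : p ∈ offInt) :
    DifferentiableAt ℂ (fun p : ℂ × ℂ => Rop τ μ ξ f p.1 p.2) p := by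
  simp only [Rop_eq_RopNum_div, div_eq_mul_inv]
  refine ((differentiableOn_RopNum hτ μ ξ hf).differentiableAt
    (((isOpen_strip τ).prod (isOpen_strip τ)).mem_nhds hp)).fun_mul (DifferentiableAt.fun_inv ?_ <|
    theta1_sub_ne_zero hτ hp.1 hp.2 hpA)
  exact (differentiable_theta1 hτ _).comp (f := fun p : ℂ × ℂ => p.2 - p.1) p (by fun_prop)

/-- The value on the diagonal of the holomorphic extension of `Rop`. -/
noncomputable def RopDiag (τ μ ξ : ℂ) (f : ℂ → ℂ → ℂ) (z : ℂ) : ℂ :=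
  (theta1 τ ξ * deriv (theta1 τ) (-μ) + deriv (theta1 τ) (-ξ) * theta1 τ (-μ)) /
      theta1 τ (-μ) * f z z
    + theta1 τ ξ * (deriv (fun w => f w z) z - deriv (fun w => f z w) z)

lemma tendsto_Rop_diag {τ : ℂ} (hτ : 0 < τ.im) {μ : ℂ} (ξ : ℂ) (hμ : theta1 τ (-μ) ≠ 0)
    {f : ℂ → ℂ → ℂ}
    (hf : DifferentiableOn ℂ (fun p : ℂ × ℂ => f p.1 p.2) (strip τ ×ˢ strip τ)) {a : ℂ}
    (ha : a ∈ strip τ) :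
    Tendsto (fun p : ℂ × ℂ => Rop τ μ ξ f p.1 p.2) (𝓝[offInt] (a, a))
      (𝓝 (RopDiag τ μ ξ f a)) := by
  have hU : IsOpen (strip τ ×ˢ strip τ) := (isOpen_strip τ).prod (isOpen_strip τ)
  have haU : (a, a) ∈ strip τ ×ˢ strip τ := ⟨ha, ha⟩
  have hθ := differentiable_theta1 hτ
  have hd0 := deriv_theta1_zero_ne_zero hτ
  obtain ⟨L, hL⟩ := (differentiableOn_RopNum hτ μ ξ hf).exists_hasStrictFDerivAt hU haU
  have hfa := hf.differentiableAt (hU.mem_nhds haU)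
  have hf1 : HasDerivAt (fun w => f w a) (deriv (fun w => f w a) a) a :=
    (hfa.comp (f := fun w : ℂ => (w, a)) a (by fun_prop)).hasDerivAt
  have hf2 : HasDerivAt (fun w => f a w) (deriv (fun w => f a w) a) a :=
    (hfa.comp (f := fun w : ℂ => (a, w)) a (by fun_prop)).hasDerivAt
  have hθc (c : ℂ) : HasDerivAt (fun w => theta1 τ (w - a - c)) (deriv (theta1 τ) (-c)) a := by
    have h : HasDerivAt (theta1 τ) (deriv (theta1 τ) (-c)) (a - a - c) := by
      simpa using (hθ (-c)).hasDerivAt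
    simpa using! h.comp a (((hasDerivAt_id a).sub_const a).sub_const c)
  have hL1 : L (0, 1) = deriv (theta1 τ) 0 * RopDiag τ μ ξ f a := by
    have e1 : HasDerivAt (fun w => RopNum τ μ ξ f (a, w)) (L (0, 1)) a :=
      hL.hasFDerivAt.comp_hasDerivAt a ((hasDerivAt_const a a).prodMk (hasDerivAt_id a))
    have e2 := (((((hθc μ).const_mul (theta1 τ ξ)).mul_const (deriv (theta1 τ) 0)).div_const
      (theta1 τ (-μ))).mul hf1).add (((hθc ξ).mul_const (deriv (theta1 τ) 0)).mul hf2)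
    rw [e1.unique e2, RopDiag]
    simp only [sub_self, zero_sub, theta1_neg τ ξ]
    field_simp
    ring
  have hdiag (z : ℂ) : RopNum τ μ ξ f (z, z) = 0 := by
    simp only [RopNum, sub_self, zero_sub, theta1_neg τ ξ]
    field_simp
    ring
  have hne : ∀ p ∈ offInt, p.2 - p.1 ≠ 0 := fun p hp h => hp ⟨0, by simpa using h⟩
  have hlim := hL.tendsto_div_sub hdiag hne
  have hθ0 : theta1 τ 0 = 0 := by
    have h := theta1_neg τ 0
    rw [neg_zero] at h
    exact self_eq_neg.mp h
  have hquot : Tendsto (fun p : ℂ × ℂ => theta1 τ (p.2 - p.1) / (p.2 - p.1)) (𝓝[offInt] (a, a))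
      (𝓝 (deriv (theta1 τ) 0)) := by
    have h := hasDerivAt_iff_tendsto_slope.mp (hθ 0).hasDerivAt
    have ht : Tendsto (fun p : ℂ × ℂ => p.2 - p.1) (𝓝[offInt] (a, a)) (𝓝[≠] 0) := by
      refine tendsto_nhdsWithin_iff.mpr ⟨?_, ?_⟩
      · have := (Continuous.tendsto (f := fun p : ℂ × ℂ => p.2 - p.1) (by fun_prop) (a, a))
        simp only [sub_self] at this
        exact this.mono_left nhdsWithin_le_nhds
      · filter_upwards [self_mem_nhdsWithin] with p hp using hne p hp
    refine (h.comp ht).congr fun p => ?_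
    simp [slope_def_field, hθ0]
  have h := hlim.div hquot hd0
  rw [hL1, mul_div_cancel_left₀ _ hd0] at h
  refine h.congr' ?_
  filter_upwards [self_mem_nhdsWithin] with p hp
  rw [Pi.div_apply, Rop_eq_RopNum_div, div_div_div_cancel_right₀ (hne p hp)]

lemma tendsto_Rop_diag_shift {τ : ℂ} (hτ : 0 < τ.im) {μ : ℂ} (ξ : ℂ) (hμ : theta1 τ (-μ) ≠ 0)
    {f : ℂ → ℂ → ℂ}
    (hf : DifferentiableOn ℂ (fun p : ℂ × ℂ => f p.1 p.2) (strip τ ×ˢ strip τ))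
    (hper1 : ∀ z₁ z₂, f (z₁ + 1) z₂ = f z₁ z₂) (hper2 : ∀ z₁ z₂, f z₁ (z₂ + 1) = f z₁ z₂) {a : ℂ}
    (ha : a ∈ strip τ) (m : ℤ) :
    Tendsto (fun p : ℂ × ℂ => Rop τ μ ξ f p.1 p.2) (𝓝[offInt] (a, a + m))
      (𝓝 (RopDiag τ μ ξ f a)) := by
  have ht : Tendsto (fun p : ℂ × ℂ => (p.1, p.2 - m)) (𝓝[offInt] (a, a + m))
      (𝓝[offInt] (a, a)) := by
    refine tendsto_nhdsWithin_iff.mpr ⟨?_, ?_⟩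
    · have := (Continuous.tendsto (f := fun p : ℂ × ℂ => (p.1, p.2 - (m : ℂ))) (by fun_prop)
        (a, a + m))
      simp only [add_sub_cancel_right] at this
      exact this.mono_left nhdsWithin_le_nhds
    · filter_upwards [self_mem_nhdsWithin] with p hp ⟨n, hn⟩
      exact hp ⟨n + m, by push_cast; linear_combination hn⟩
  refine ((tendsto_Rop_diag hτ ξ hμ hf ha).comp ht).congr fun p => ?_
  rw [Function.comp_apply, ← Rop_add_intCast τ μ ξ hper1 hper2 _ _ m, sub_add_cancel]

/-- The singularities of `Ř(ξ)f` along `z₂ - z₁ ∈ ℤ` are removable, and the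
holomorphic extension takes the stated value on the diagonal shifts. -/
theorem rop_removable_singularities (τ : ℂ) (hτ : 0 < τ.im) (μ ξ : ℂ)
    (hμ : ¬∃ a b : ℤ, μ = (a : ℂ) + (b : ℂ) * τ)
    (f : ℂ → ℂ → ℂ)
    (hf : DifferentiableOn ℂ (fun p : ℂ × ℂ => f p.1 p.2) (strip τ ×ˢ strip τ))
    (hper1 : ∀ z₁ z₂, f (z₁ + 1) z₂ = f z₁ z₂)
    (hper2 : ∀ z₁ z₂, f z₁ (z₂ + 1) = f z₁ z₂) :
    ∃ F : ℂ → ℂ → ℂ,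
      (DifferentiableOn ℂ (fun p : ℂ × ℂ => F p.1 p.2) (strip τ ×ˢ strip τ) ∧
        ∀ z₁ ∈ strip τ, ∀ z₂ ∈ strip τ, (¬∃ m : ℤ, z₂ - z₁ = (m : ℂ)) →
          F z₁ z₂ = Rop τ μ ξ f z₁ z₂) ∧
      (∀ G : ℂ → ℂ → ℂ,
        (DifferentiableOn ℂ (fun p : ℂ × ℂ => G p.1 p.2) (strip τ ×ˢ strip τ) ∧
          ∀ z₁ ∈ strip τ, ∀ z₂ ∈ strip τ, (¬∃ m : ℤ, z₂ - z₁ = (m : ℂ)) →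
            G z₁ z₂ = Rop τ μ ξ f z₁ z₂) →
        ∀ z₁ ∈ strip τ, ∀ z₂ ∈ strip τ, G z₁ z₂ = F z₁ z₂) ∧
      (∀ z ∈ strip τ, ∀ m : ℤ, (z + (m : ℂ)) ∈ strip τ →
        F z (z + (m : ℂ)) =
          (theta1 τ ξ * deriv (theta1 τ) (-μ) + deriv (theta1 τ) (-ξ) * theta1 τ (-μ)) /
              theta1 τ (-μ) * f z z
            + theta1 τ ξ * (deriv (fun w => f w z) z - deriv (fun w => f z w) z)) := by
  have hU : IsOpen (strip τ ×ˢ strip τ) := (isOpen_strip τ).prod (isOpen_strip τ)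
  have hμ0 : theta1 τ (-μ) ≠ 0 := by
    rw [theta1_neg, neg_ne_zero]
    exact fun h => hμ (exists_eq_of_theta1_eq_zero hτ h)
  set R : ℂ × ℂ → ℂ := fun p => Rop τ μ ξ f p.1 p.2 with hR
  have hlim_off {p : ℂ × ℂ} (hp : p ∈ strip τ ×ˢ strip τ) (hpA : p ∈ offInt) :
      Tendsto R (𝓝[offInt] p) (𝓝 (R p)) :=
    (differentiableAt_Rop hτ μ ξ hf hp hpA).continuousAt.tendsto.mono_left nhdsWithin_le_nhds
  have hlim_diag {z : ℂ} (hz : z ∈ strip τ) (m : ℤ) :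
      Tendsto R (𝓝[offInt] (z, z + m)) (𝓝 (RopDiag τ μ ξ f z)) :=
    tendsto_Rop_diag_shift hτ ξ hμ0 hf hper1 hper2 hz m
  have hlim : ∀ p ∈ strip τ ×ˢ strip τ, ∃ y, Tendsto R (𝓝[offInt] p) (𝓝 y) := by
    rintro ⟨z₁, z₂⟩ hp
    by_cases hpA : (z₁, z₂) ∈ offInt
    · exact ⟨_, hlim_off hp hpA⟩
    · obtain ⟨m, hm⟩ := not_not.mp hpA
      obtain rfl : z₂ = z₁ + m := by linear_combination hm
      exact ⟨_, hlim_diag hp.1 m⟩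
  have hF_off {p : ℂ × ℂ} (hp : p ∈ strip τ ×ˢ strip τ) (hpA : p ∈ offInt) :
      extendFrom offInt R p = R p := extendFrom_eq (dense_offInt p) (hlim_off hp hpA)
  refine ⟨fun z₁ z₂ => extendFrom offInt R (z₁, z₂), ⟨?_, ?_⟩, ?_, ?_⟩
  · refine differentiableOn_of_continuousOn_of_punctured hU
      (continuousOn_extendFrom (fun p _ => dense_offInt p) hlim) (fun p hp => ?_)
      (fun p _ => eventually_mem_offInt_fst p) (fun p _ => eventually_mem_offInt_snd p)
    refine (differentiableAt_Rop hτ μ ξ hf hp.1 hp.2).congr_of_eventuallyEq ?_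
    filter_upwards [(hU.inter isOpen_offInt).mem_nhds hp] with q hq using hF_off hq.1 hq.2
  · exact fun z₁ h1 z₂ h2 h => hF_off (p := (z₁, z₂)) ⟨h1, h2⟩ h
  · rintro G ⟨hG, hGR⟩ z₁ h1 z₂ h2
    have hp : (z₁, z₂) ∈ strip τ ×ˢ strip τ := ⟨h1, h2⟩
    have hGt := (hG.continuousOn.continuousAt (hU.mem_nhds hp)).tendsto.mono_left
      (nhdsWithin_le_nhds (s := offInt))
    refine (extendFrom_eq (dense_offInt _) (hGt.congr' ?_)).symm
    filter_upwards [self_mem_nhdsWithin, nhdsWithin_le_nhds (hU.mem_nhds hp)] with q hqA hq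
    exact hGR q.1 hq.1 q.2 hq.2 hqA
  · exact fun z hz m _ => extendFrom_eq (dense_offInt _) (hlim_diag hz m)
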